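/- arXiv:2501.00837 — 3 statements merged into one kernel-verified Lean document; each statement's English description precedes it below -/
import Mathlib

section
/- Under the exclusion restriction, IV independence, and IV positivity assumptions, the observable conditional probabilities satisfy the eight identities: q_{000} = p_{00,01} + p_{00,00} + p_{01,01} + p_{01,00}; q_{001} = p_{00,10} + p_{00,11} + p_{01,11} + p_{01,10}; q_{010} = p_{11,10} + p_{11,00} + p_{10,10} + p_{10,00}; q_{011} = p_{11,01} + p_{11,11} + p_{10,11} + p_{10,01}; q_{100} = p_{00,01} + p_{00,00} + p_{10,01} + p_{10,00}; q_{101} = p_{00,10} + p_{00,11} + p_{10,11} + p_{10,10}; q_{110} = p_{11,10} + p_{11,00} + p_{01,10} + p_{01,00}; q_{111} = p_{11,01} + p_{11,11} + p_{01,11} + p_{01,01}. -/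
open MeasureTheory ProbabilityTheory
open scoped ENNReal ProbabilityTheory

/-- **Proposition 1 (link between counterfactual and observable probabilities).**
Under the exclusion restriction (`Y = Y_A`, built into the definition of `Y`),
IV independence, and IV positivity, the observable conditional probabilities
`q z a y = P(A = a, Y = y | Z = z)` satisfy the eight identities linking them to the
counterfactual probabilities `p i j k l = P(A₀ = i, A₁ = j, Y₀ = k, Y₁ = l)`. -/
theorem observable_eq_counterfactual_sums
    {Ω : Type*} [MeasurableSpace Ω] (P : Measure Ω) [IsProbabilityMeasure P]
    (Z A0 A1 Y0 Y1 A Y : Ω → Fin 2)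
    (hZ : Measurable Z) (hA0 : Measurable A0) (hA1 : Measurable A1)
    (hY0 : Measurable Y0) (hY1 : Measurable Y1)
    -- consistency: `A = A_Z`
    (hA : ∀ ω, A ω = if Z ω = 1 then A1 ω else A0 ω)
    -- exclusion restriction + consistency: `Y = Y_A`
    (hY : ∀ ω, Y ω = if A ω = 1 then Y1 ω else Y0 ω)
    -- IV independence: `Z ⟂ (Y₀, Y₁, A₀, A₁)`
    (hindep : IndepFun Z (fun ω => (Y0 ω, Y1 ω, A0 ω, A1 ω)) P)
    -- IV positivity
    (hpos : 0 < P {ω | Z ω = 1} ∧ P {ω | Z ω = 1} < 1)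
    (p : Fin 2 → Fin 2 → Fin 2 → Fin 2 → ℝ)
    (hp : ∀ i j k l, p i j k l =
      (P {ω | A0 ω = i ∧ A1 ω = j ∧ Y0 ω = k ∧ Y1 ω = l}).toReal)
    (q : Fin 2 → Fin 2 → Fin 2 → ℝ)
    (hq : ∀ z a y, q z a y = (P[|{ω | Z ω = z}] {ω | A ω = a ∧ Y ω = y}).toReal) :
    q 0 0 0 = p 0 0 0 1 + p 0 0 0 0 + p 0 1 0 1 + p 0 1 0 0 ∧
    q 0 0 1 = p 0 0 1 0 + p 0 0 1 1 + p 0 1 1 1 + p 0 1 1 0 ∧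
    q 0 1 0 = p 1 1 1 0 + p 1 1 0 0 + p 1 0 1 0 + p 1 0 0 0 ∧
    q 0 1 1 = p 1 1 0 1 + p 1 1 1 1 + p 1 0 1 1 + p 1 0 0 1 ∧
    q 1 0 0 = p 0 0 0 1 + p 0 0 0 0 + p 1 0 0 1 + p 1 0 0 0 ∧
    q 1 0 1 = p 0 0 1 0 + p 0 0 1 1 + p 1 0 1 1 + p 1 0 1 0 ∧
    q 1 1 0 = p 1 1 1 0 + p 1 1 0 0 + p 0 1 1 0 + p 0 1 0 0 ∧
    q 1 1 1 = p 1 1 0 1 + p 1 1 1 1 + p 0 1 1 1 + p 0 1 0 1 := by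
  have hW : Measurable (fun ω => (Y0 ω, Y1 ω, A0 ω, A1 ω)) := by fun_prop
  have hZpos : ∀ z, P {ω | Z ω = z} ≠ 0 := by
    intro z hz
    have hc : z = 0 ∨ z = 1 := by fin_cases z <;> simp
    rcases hc with rfl | rfl
    · have h1 : P {ω | Z ω = 0}ᶜ = 1 :=
        (prob_compl_eq_one_iff (hZ (measurableSet_singleton 0))).2 hz
      have h2 : {ω | Z ω = 0}ᶜ = {ω | Z ω = 1} := by
        ext ω
        simp only [Set.mem_compl_iff, Set.mem_setOf_eq]
        omega
      rw [h2] at h1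
      exact hpos.2.ne h1
    · exact hpos.1.ne' hz
  have key : ∀ z a y, q z a y =
      ∑ w : Fin 2 × Fin 2 × Fin 2 × Fin 2,
        if (if z = 1 then w.2.2.2 else w.2.2.1) = a ∧ (if a = 1 then w.2.1 else w.1) = y
        then p w.2.2.1 w.2.2.2 w.1 w.2.1 else 0 := by
    intro z a y
    rw [← Finset.sum_filter]
    set S : Finset (Fin 2 × Fin 2 × Fin 2 × Fin 2) := Finset.univ.filter
      (fun w => (if z = 1 then w.2.2.2 else w.2.2.1) = a ∧ (if a = 1 then w.2.1 else w.1) = y)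
      with hS
    have hq1 : q z a y = P.real ((fun ω => (Y0 ω, Y1 ω, A0 ω, A1 ω)) ⁻¹' (S : Set _)) := by
      have hmZ : MeasurableSet {ω | Z ω = z} := hZ (measurableSet_singleton z)
      have hset : {ω | Z ω = z} ∩ {ω | A ω = a ∧ Y ω = y} =
          Z ⁻¹' {z} ∩ (fun ω => (Y0 ω, Y1 ω, A0 ω, A1 ω)) ⁻¹' (S : Set _) := by
        ext ω
        simp only [hS, Set.mem_inter_iff, Set.mem_setOf_eq, Set.mem_preimage,
          Set.mem_singleton_iff, Finset.coe_filter, Finset.mem_univ, true_and]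
        rw [hY, hA]
        constructor
        · rintro ⟨rfl, rfl, rfl⟩
          exact ⟨rfl, rfl, rfl⟩
        · rintro ⟨rfl, rfl, rfl⟩
          exact ⟨rfl, rfl, rfl⟩
      rw [hq, cond_apply hmZ, hset,
        hindep.measure_inter_preimage_eq_mul _ _ (measurableSet_singleton z)
          S.measurableSet, ← mul_assoc]
      have h3 : (P {ω | Z ω = z})⁻¹ * P (Z ⁻¹' {z}) = 1 :=
        ENNReal.inv_mul_cancel (hZpos z) (measure_ne_top _ _)
      rw [h3, one_mul]
      rfl
    rw [hq1, ← sum_measureReal_preimage_singleton S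
      (fun w _ => hW (measurableSet_singleton w))]
    refine Finset.sum_congr rfl fun w _ => ?_
    rw [hp, measureReal_def]
    congr 2
    ext ω
    simp only [Set.mem_preimage, Set.mem_singleton_iff, Set.mem_setOf_eq, Prod.ext_iff]
    tauto
  refine ⟨?_, ?_, ?_, ?_, ?_, ?_, ?_, ?_⟩ <;>
  · rw [key]
    simp [Fintype.sum_prod_type, Fin.sum_univ_two]
    try ring
end

section
/- Let N_z = (n_{z00}, n_{z01}, n_{z10}, n_{z11}) be independent Multinomial(n_z, q_z) for z in {0,1}, and given N_z = n_z for z in {0,1}, let (V_z*, V*_{z00}, V*_{z01}, V*_{z10}, V*_{z11}) be independent Dirichlet(1, n_z) for z in {0,1}. Let S_z be the random subset of the 3-dimensional probability simplex consisting of all q' with V*_{zay} ≤ q'_{ay} for all a,y in {0,1}. If the concatenated vector q = (q_0, q_1) lies in the interior of the feasibility set F, then the conditional probability P*((S_0 × S_1) ∩ F ≠ ∅), as a function of the observed counts, converges to 1 in probability as n_0, n_1 tend to infinity. -/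
open MeasureTheory ProbabilityTheory Filter Matrix
open scoped ENNReal NNReal Topology

/-- The categorical distribution on a finite type. -/
noncomputable def categorical {ι : Type*} [Fintype ι] [MeasurableSpace ι] (q : ι → ℝ) :
    Measure ι := ∑ i : ι, ENNReal.ofReal (q i) • Measure.dirac i

/-- The multinomial distribution of category counts for `n` independent trials. -/
noncomputable def multinomial (ι : Type*) [Fintype ι] [DecidableEq ι] [MeasurableSpace ι]
    (n : ℕ) (q : ι → ℝ) : Measure (ι → ℕ) :=
  Measure.map (fun (x : Fin n → ι) (j : ι) => (Finset.univ.filter (fun i => x i = j)).card)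
    (Measure.pi fun _ : Fin n => categorical q)

/-- The Gamma distribution with shape `a` and rate `1`, with the convention
`Gamma(0, 1) = δ₀`. -/
noncomputable def gammaShape (a : ℝ) : Measure ℝ :=
  if a = 0 then Measure.dirac 0 else gammaMeasure a 1

/-- The Dirichlet distribution with shape vector `a`: the law of
`(X i / ∑ j, X j) i` for independent `X i ~ Gamma(a i, 1)`. -/
noncomputable def dirichlet {ι : Type*} [Fintype ι] (a : ι → ℝ) : Measure (ι → ℝ) :=
  Measure.map (fun x i => x i / ∑ j : ι, x j) (Measure.pi fun i : ι => gammaShape (a i))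

/-- The eight identities linking the counterfactual probabilities `p i j k l`
(`i = A₀, j = A₁, k = Y₀, l = Y₁`) to the observable probabilities
`q0 (a, y) = q_{0ay}` and `q1 (a, y) = q_{1ay}`. -/
def linkEqs (p : Fin 2 → Fin 2 → Fin 2 → Fin 2 → ℝ)
    (q0 q1 : Fin 2 × Fin 2 → ℝ) : Prop :=
  q0 (0, 0) = p 0 0 0 1 + p 0 0 0 0 + p 0 1 0 1 + p 0 1 0 0 ∧
  q0 (0, 1) = p 0 0 1 0 + p 0 0 1 1 + p 0 1 1 1 + p 0 1 1 0 ∧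
  q0 (1, 0) = p 1 1 1 0 + p 1 1 0 0 + p 1 0 1 0 + p 1 0 0 0 ∧
  q0 (1, 1) = p 1 1 0 1 + p 1 1 1 1 + p 1 0 1 1 + p 1 0 0 1 ∧
  q1 (0, 0) = p 0 0 0 1 + p 0 0 0 0 + p 1 0 0 1 + p 1 0 0 0 ∧
  q1 (0, 1) = p 0 0 1 0 + p 0 0 1 1 + p 1 0 1 1 + p 1 0 1 0 ∧
  q1 (1, 0) = p 1 1 1 0 + p 1 1 0 0 + p 0 1 1 0 + p 0 1 0 0 ∧
  q1 (1, 1) = p 1 1 0 1 + p 1 1 1 1 + p 0 1 1 1 + p 0 1 0 1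

/-- The feasibility set `F`: pairs of points of the 3-dimensional probability simplex for
which there exist nonnegative counterfactual probabilities `p i j k l` summing to `1`
satisfying the eight identities. -/
def Feas : Set (((Fin 2 × Fin 2) → ℝ) × ((Fin 2 × Fin 2) → ℝ)) :=
  {qq | qq.1 ∈ stdSimplex ℝ (Fin 2 × Fin 2) ∧ qq.2 ∈ stdSimplex ℝ (Fin 2 × Fin 2) ∧
    ∃ p : Fin 2 → Fin 2 → Fin 2 → Fin 2 → ℝ,
      (∀ i j k l, 0 ≤ p i j k l) ∧
      (∑ i : Fin 2, ∑ j : Fin 2, ∑ k : Fin 2, ∑ l : Fin 2, p i j k l) = 1 ∧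
      linkEqs p qq.1 qq.2}

/-- The Dirichlet shape vector `(1, c)` associated with a table of counts `c`. -/
def shapeOf (c : (Fin 2 × Fin 2) → ℕ) : Option (Fin 2 × Fin 2) → ℝ :=
  fun o => o.elim 1 (fun ay => (c ay : ℝ))

/-- The random polytope `S_z`: all points `q'` of the 3-dimensional probability simplex
with `V*_{zay} ≤ q'_{ay}` for all `a, y`. -/
def SzSet (v : Option (Fin 2 × Fin 2) → ℝ) : Set ((Fin 2 × Fin 2) → ℝ) :=
  {q' | q' ∈ stdSimplex ℝ (Fin 2 × Fin 2) ∧ ∀ ay : Fin 2 × Fin 2, v (some ay) ≤ q' ay}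

/-- The fiducial acceptance probability `P*((S₀ × S₁) ∩ F ≠ ∅)`: the probability, under
independent Dirichlet `(1, c0)` and `(1, c1)` fiducial randomness given the observed
counts `c0, c1`, that the random set `S₀ × S₁` meets the feasibility set `F`. -/
noncomputable def acceptProb (c0 c1 : (Fin 2 × Fin 2) → ℕ) : ℝ≥0∞ :=
  ((dirichlet (shapeOf c0)).prod (dirichlet (shapeOf c1)))
    {vv | ((SzSet vv.1 ×ˢ SzSet vv.2) ∩ Feas).Nonempty}


lemma gamma_moment {a : ℝ} (ha : 0 < a) :
    ∫⁻ x, ENNReal.ofReal ((x - a) ^ 2 * gammaPDFReal a 1 x) = ENNReal.ofReal a := by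
  have key : ∀ x : ℝ, ENNReal.ofReal ((x - a) ^ 2 * gammaPDFReal a 1 x)
      + ENNReal.ofReal (2 * a ^ 2) * gammaPDF (a + 1) 1 x
      = ENNReal.ofReal (a * (a + 1)) * gammaPDF (a + 2) 1 x
        + ENNReal.ofReal (a ^ 2) * gammaPDF a 1 x := by
    intro x
    have n0 := gammaPDFReal_nonneg ha one_pos x
    have n1 := gammaPDFReal_nonneg (a := a + 1) (by linarith) one_pos x
    have n2 := gammaPDFReal_nonneg (a := a + 2) (by linarith) one_pos x
    unfold gammaPDF
    rw [← ENNReal.ofReal_mul (by positivity), ← ENNReal.ofReal_mul (by positivity),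
      ← ENNReal.ofReal_mul (by positivity), ← ENNReal.ofReal_add (by positivity) (by positivity),
      ← ENNReal.ofReal_add (by positivity) (by positivity)]
    congr 1
    unfold gammaPDFReal
    by_cases hx : 0 ≤ x
    · simp only [hx, if_true, Real.one_rpow]
      have hG : Real.Gamma a ≠ 0 := (Real.Gamma_pos_of_pos ha).ne'
      have g1 : Real.Gamma (a + 1) = a * Real.Gamma a := Real.Gamma_add_one ha.ne'
      have g2 : Real.Gamma (a + 2) = (a + 1) * (a * Real.Gamma a) := by
        rw [← g1, ← Real.Gamma_add_one (by linarith)]; ring_nf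
      rw [g1, g2]
      rcases hx.eq_or_lt with h0 | hpos
      · subst h0
        have e1 : (0 : ℝ) ^ (a + 1 - 1) = 0 := Real.zero_rpow (by linarith)
        have e2 : (0 : ℝ) ^ (a + 2 - 1) = 0 := Real.zero_rpow (by linarith)
        rw [e1, e2]; ring
      · have e1 : x ^ (a + 1 - 1) = x ^ (a - 1) * x := by
          rw [← Real.rpow_add_one hpos.ne']; ring_nf
        have e2 : x ^ (a + 2 - 1) = x ^ (a - 1) * x * x := by
          rw [← Real.rpow_add_one hpos.ne', ← Real.rpow_add_one hpos.ne']; ring_nf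
        rw [e1, e2]
        field_simp
        ring
    · simp [hx]
  have hm : ∀ b, Measurable (gammaPDF b 1) := fun b =>
    (measurable_gammaPDFReal b 1).ennreal_ofReal
  have hI := lintegral_congr (μ := volume) key
  rw [lintegral_add_right _ ((hm _).const_mul _), lintegral_add_right _ ((hm _).const_mul _),
    lintegral_const_mul _ (hm _), lintegral_const_mul _ (hm _), lintegral_const_mul _ (hm _),
    lintegral_gammaPDF_eq_one ha one_pos, lintegral_gammaPDF_eq_one (by linarith) one_pos,
    lintegral_gammaPDF_eq_one (by linarith) one_pos, mul_one, mul_one, mul_one,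
    ← ENNReal.ofReal_add (by positivity) (by positivity)] at hI
  have : a * (a + 1) + a ^ 2 = a + 2 * a ^ 2 := by ring
  rw [this, ENNReal.ofReal_add ha.le (by positivity)] at hI
  exact (ENNReal.add_left_inj ENNReal.ofReal_ne_top).1 hI

instance gammaShape_prob (a : ℝ≥0) : IsProbabilityMeasure (gammaShape a) := by
  unfold gammaShape
  split_ifs with h
  · infer_instance
  · exact isProbabilityMeasure_gammaMeasure (lt_of_le_of_ne a.2 (Ne.symm h)) one_pos

lemma gammaShape_cheb {a t : ℝ} (ha : 0 ≤ a) (ht : 0 < t) :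
    gammaShape a {x | ¬ (0 ≤ x ∧ |x - a| < t)} ≤ ENNReal.ofReal (a / t ^ 2) := by
  have hB : MeasurableSet {x : ℝ | ¬ (0 ≤ x ∧ |x - a| < t)} := by
    have : IsOpen {x : ℝ | |x - a| < t} := isOpen_lt (by fun_prop) (by fun_prop)
    exact (measurableSet_Ici.inter this.measurableSet).compl
  unfold gammaShape
  split_ifs with h
  · subst h
    rw [Measure.dirac_apply' _ hB]
    simp [ht]
  · have ha' : 0 < a := lt_of_le_of_ne ha (Ne.symm h)
    rw [gammaMeasure, withDensity_apply _ hB]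
    calc ∫⁻ x in {x : ℝ | ¬ (0 ≤ x ∧ |x - a| < t)}, gammaPDF a 1 x
        ≤ ∫⁻ x in {x : ℝ | ¬ (0 ≤ x ∧ |x - a| < t)},
            ENNReal.ofReal (1 / t ^ 2) * ENNReal.ofReal ((x - a) ^ 2 * gammaPDFReal a 1 x) := by
          apply setLIntegral_mono' hB
          intro x hx
          by_cases h0 : 0 ≤ x
          · have h1 : t ≤ |x - a| := by
              by_contra hc; exact hx ⟨h0, not_le.1 hc⟩
            have h2 : t ^ 2 ≤ (x - a) ^ 2 := by
              rw [← sq_abs (x - a)]; gcongr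
            rw [← ENNReal.ofReal_mul (by positivity), gammaPDF]
            apply ENNReal.ofReal_le_ofReal
            have n0 := gammaPDFReal_nonneg ha' one_pos x
            rw [← mul_assoc]
            apply le_mul_of_one_le_left n0
            rw [one_div, inv_mul_eq_div, le_div_iff₀ (by positivity)]
            linarith
          · rw [gammaPDF_of_neg (not_le.1 h0)]; exact zero_le
      _ ≤ ∫⁻ x, ENNReal.ofReal (1 / t ^ 2) *
            ENNReal.ofReal ((x - a) ^ 2 * gammaPDFReal a 1 x) := setLIntegral_le_lintegral _ _
      _ = ENNReal.ofReal (a / t ^ 2) := by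
          rw [lintegral_const_mul _ (by fun_prop), gamma_moment ha',
            ← ENNReal.ofReal_mul (by positivity)]
          congr 1; ring

lemma categorical_prob {ι : Type*} [Fintype ι] [MeasurableSpace ι] {q : ι → ℝ}
    (hq : q ∈ stdSimplex ℝ ι) : IsProbabilityMeasure (categorical q) := by
  constructor
  simp only [categorical, Measure.coe_finsetSum, Finset.sum_apply, Measure.smul_apply,
    measure_univ, smul_eq_mul, mul_one]
  rw [← ENNReal.ofReal_sum_of_nonneg (fun i _ => hq.1 i), hq.2, ENNReal.ofReal_one]

lemma multinomial_measurable {ι : Type*} [Fintype ι] [DecidableEq ι] [MeasurableSpace ι]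
    [DiscreteMeasurableSpace ι] (n : ℕ) : Measurable
    (fun (x : Fin n → ι) (j : ι) => (Finset.univ.filter (fun i => x i = j)).card) :=
  Measurable.of_discrete

lemma multinomial_prob {ι : Type*} [Fintype ι] [DecidableEq ι] [MeasurableSpace ι]
    [DiscreteMeasurableSpace ι] (n : ℕ) {q : ι → ℝ}
    (hq : q ∈ stdSimplex ℝ ι) : IsProbabilityMeasure (multinomial ι n q) := by
  have := categorical_prob hq
  exact Measure.isProbabilityMeasure_map (multinomial_measurable n).aemeasurable

lemma multinomial_cheb {ι : Type*} [Fintype ι] [DecidableEq ι] [MeasurableSpace ι]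
    [DiscreteMeasurableSpace ι] (n : ℕ) {q : ι → ℝ}
    (hq : q ∈ stdSimplex ℝ ι) (j : ι) {t : ℝ} (ht : 0 < t) :
    multinomial ι n q {c | t ≤ |(c j : ℝ) - n * q j|} ≤ ENNReal.ofReal (n / t ^ 2) := by
  have := categorical_prob hq
  let X : ι → ℝ := fun k => if k = j then 1 else 0
  have hX : MemLp X 2 (categorical q) := by
    apply MemLp.of_bound (Measurable.of_discrete).aestronglyMeasurable 1
    refine ae_of_all _ fun k => ?_
    simp only [X]; split_ifs <;> simp
  have hEX : ∫ k, X k ∂(categorical q) = q j := by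
    unfold categorical
    rw [integral_finsetSum_measure]
    · simp only [integral_smul_measure, integral_dirac, X]
      simp [ENNReal.toReal_ofReal (hq.1 j)]
    · intro i _
      exact (integrable_dirac (by simp)).smul_measure ENNReal.ofReal_ne_top
  have hVX : variance X (categorical q) ≤ 1 := by
    refine (variance_le_expectation_sq hX.1).trans ?_
    have : ∫ k, (X ^ 2) k ∂(categorical q) ≤ ∫ k, (1 : ℝ) ∂(categorical q) := by
      apply integral_mono_of_nonneg
      · exact ae_of_all _ fun k => by simp only [Pi.pow_apply, Pi.zero_apply]; positivity
      · exact integrable_const _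
      · refine ae_of_all _ fun k => ?_
        simp only [X, Pi.pow_apply]; split_ifs <;> simp
    simpa using this
  let Y : (Fin n → ι) → ℝ := ∑ i : Fin n, fun x => X (x i)
  have hXi : ∀ i : Fin n, MemLp (fun x : Fin n → ι => X (x i)) 2
      (Measure.pi fun _ : Fin n => categorical q) := fun i =>
    hX.comp_measurePreserving (measurePreserving_eval (fun _ : Fin n => categorical q) i)
  have hY : MemLp Y 2 (Measure.pi fun _ : Fin n => categorical q) :=
    memLp_finsetSum' _ fun i _ => hXi i
  have hEY : ∫ x, Y x ∂(Measure.pi fun _ : Fin n => categorical q) = n * q j := by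
    simp only [Y, Finset.sum_apply]
    rw [integral_finsetSum _ fun i _ => (hXi i).integrable (by norm_num)]
    have : ∀ i : Fin n, ∫ x : Fin n → ι, X (x i) ∂(Measure.pi fun _ : Fin n => categorical q)
        = q j := by
      intro i
      rw [← hEX]
      exact integral_comp_eval (μ := fun _ : Fin n => categorical q) hX.1
    simp [this]
  have hVY : variance Y (Measure.pi fun _ : Fin n => categorical q) ≤ n := by
    rw [variance_sum_pi (fun _ => hX)]
    calc _ ≤ ∑ i : Fin n, (1 : ℝ) := Finset.sum_le_sum fun i _ => hVX
      _ = n := by simp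
  unfold multinomial
  rw [Measure.map_apply (multinomial_measurable n) (Set.to_countable _).measurableSet]
  have hc := meas_ge_le_variance_div_sq hY ht
  rw [hEY] at hc
  refine le_trans (le_of_eq ?_) (hc.trans (ENNReal.ofReal_le_ofReal (by gcongr)))
  congr 1
  ext x
  simp [Y, X]

/-- The fiducial vectors whose midpoint completion is `η`-close to `q`. -/
def goodV (q : (Fin 2 × Fin 2) → ℝ) (η : ℝ) : Set (Option (Fin 2 × Fin 2) → ℝ) :=
  {v | (∀ o, 0 ≤ v o) ∧ ∑ o, v o = 1 ∧ ∀ j, |v (some j) + v none / 4 - q j| < η}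

lemma measurableSet_goodV (q : (Fin 2 × Fin 2) → ℝ) (η : ℝ) : MeasurableSet (goodV q η) := by
  have h1 : MeasurableSet {v : Option (Fin 2 × Fin 2) → ℝ | ∀ o, 0 ≤ v o} := by
    rw [Set.ofPred_forall]
    exact MeasurableSet.iInter fun o => measurableSet_le measurable_const (measurable_pi_apply o)
  have h2 : MeasurableSet {v : Option (Fin 2 × Fin 2) → ℝ | ∑ o, v o = 1} :=
    measurableSet_eq_fun (by fun_prop) measurable_const
  have h3 : MeasurableSet {v : Option (Fin 2 × Fin 2) → ℝ |
      ∀ j, |v (some j) + v none / 4 - q j| < η} := by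
    rw [Set.ofPred_forall]
    refine MeasurableSet.iInter fun j => IsOpen.measurableSet ?_
    exact isOpen_lt (by fun_prop) (by fun_prop)
  exact h1.inter (h2.inter h3)

lemma good_arith {q : (Fin 2 × Fin 2) → ℝ} (hq : q ∈ stdSimplex ℝ (Fin 2 × Fin 2))
    {δ η N : ℝ} (hδ : 0 < δ) (hδ1 : δ ≤ 1 / 20) (hη : 30 * δ ≤ η) (hN : 1 ≤ δ * N)
    {c : (Fin 2 × Fin 2) → ℕ} (hc : ∀ j, |(c j : ℝ) - N * q j| < δ * N)
    {x : Option (Fin 2 × Fin 2) → ℝ}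
    (hx : ∀ o, 0 ≤ x o ∧ |x o - shapeOf c o| < δ * N) :
    (fun i => x i / ∑ j, x j) ∈ goodV q η := by
  have hN0 : 0 < N := by
    by_contra h
    have : δ * N ≤ 0 := mul_nonpos_of_nonneg_of_nonpos hδ.le (not_lt.1 h)
    linarith
  have hq1 : ∀ j, q j ≤ 1 := fun j => (mem_Icc_of_mem_stdSimplex hq j).2
  obtain ⟨hq0, hqs⟩ := hq
  have hj : ∀ j, |x (some j) - N * q j| < 2 * (δ * N) := by
    intro j
    have h1 := abs_lt.1 (hx (some j)).2
    have h2 := abs_lt.1 (hc j)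
    simp only [shapeOf, Option.elim] at h1
    rw [abs_lt]; constructor <;> linarith
  have hn := abs_lt.1 (hx none).2
  have hn0 := (hx none).1
  simp only [shapeOf, Option.elim] at hn
  set S := ∑ j, x j with hS
  have hSe : S = x none + ∑ j, x (some j) := by rw [hS, Fintype.sum_option]
  have hd : |∑ j, x (some j) - N| ≤ 8 * (δ * N) := by
    have : ∑ j, x (some j) - N = ∑ j, (x (some j) - N * q j) := by
      rw [Finset.sum_sub_distrib, ← Finset.mul_sum, hqs, mul_one]
    rw [this]
    refine (Finset.abs_sum_le_sum_abs _ _).trans ?_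
    calc _ ≤ ∑ j : Fin 2 × Fin 2, 2 * (δ * N) := Finset.sum_le_sum fun j _ => (hj j).le
      _ = _ := by simp; ring
  have hd' := abs_le.1 hd
  have hδN : δ * N ≤ 1 / 20 * N := by gcongr
  have hSlow : N / 2 ≤ S := by linarith
  have hSpos : 0 < S := by linarith
  refine ⟨fun o => div_nonneg (hx o).1 hSpos.le, ?_, ?_⟩
  · rw [← Finset.sum_div, ← hS, div_self hSpos.ne']
  · intro j
    have e : x (some j) / S + x none / S / 4 - q j
        = ((x (some j) - N * q j) + x none / 4 - q j * (S - N)) / S := by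
      field_simp; ring
    simp only [e]
    rw [abs_div, abs_of_pos hSpos, div_lt_iff₀ hSpos]
    have hj' := abs_lt.1 (hj j)
    have hE : |q j * (S - N)| ≤ 10 * (δ * N) := by
      rw [abs_mul, abs_of_nonneg (hq0 j)]
      have : |S - N| ≤ 10 * (δ * N) := by rw [abs_le]; constructor <;> linarith
      calc q j * |S - N| ≤ 1 * |S - N| := by gcongr; exact hq1 j
        _ ≤ _ := by linarith
    have hE' := abs_le.1 hE
    have hfin : 15 * (δ * N) ≤ η * S := by
      calc 15 * (δ * N) = (30 * δ) * (N / 2) := by ring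
        _ ≤ η * S := by gcongr; linarith
    rw [abs_lt]
    constructor <;> nlinarith [mul_pos hδ hN0]

lemma shapeOf_nonneg (c : (Fin 2 × Fin 2) → ℕ) (o) : 0 ≤ shapeOf c o := by
  cases o <;> simp [shapeOf]

instance gammaShape_shapeOf (c : (Fin 2 × Fin 2) → ℕ) (o) :
    IsProbabilityMeasure (gammaShape (shapeOf c o)) :=
  gammaShape_prob ⟨shapeOf c o, shapeOf_nonneg c o⟩

lemma dirichlet_measurable :
    Measurable (fun (x : Option (Fin 2 × Fin 2) → ℝ) i => x i / ∑ j, x j) := by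
  fun_prop

instance dirichlet_prob (c : (Fin 2 × Fin 2) → ℕ) :
    IsProbabilityMeasure (dirichlet (shapeOf c)) :=
  Measure.isProbabilityMeasure_map dirichlet_measurable.aemeasurable

lemma dirichlet_good {q : (Fin 2 × Fin 2) → ℝ} (hq : q ∈ stdSimplex ℝ (Fin 2 × Fin 2))
    {δ η N : ℝ} (hδ : 0 < δ) (hδ1 : δ ≤ 1 / 20) (hη : 30 * δ ≤ η) (hN : 1 ≤ δ * N)
    {c : (Fin 2 × Fin 2) → ℕ} (hc : ∀ j, |(c j : ℝ) - N * q j| < δ * N) :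
    dirichlet (shapeOf c) (goodV q η)ᶜ ≤ ENNReal.ofReal (10 / δ ^ 2 / N) := by
  have hN0 : 0 < N := by
    by_contra h
    have : δ * N ≤ 0 := mul_nonpos_of_nonneg_of_nonpos hδ.le (not_lt.1 h)
    linarith
  have hq1 : ∀ j, q j ≤ 1 := fun j => (mem_Icc_of_mem_stdSimplex hq j).2
  have hδN : δ * N ≤ 1 / 20 * N := by gcongr
  have hsh : ∀ o, shapeOf c o ≤ 2 * N := by
    intro o
    rcases o with _ | j
    · simp only [shapeOf, Option.elim]; linarith
    · simp only [shapeOf, Option.elim]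
      have h2 := abs_lt.1 (hc j)
      have : N * q j ≤ N * 1 := by gcongr; exact hq1 j
      linarith
  unfold dirichlet
  rw [Measure.map_apply dirichlet_measurable (measurableSet_goodV q η).compl]
  let B : Option (Fin 2 × Fin 2) → Set ℝ := fun o =>
    {y | ¬ (0 ≤ y ∧ |y - shapeOf c o| < δ * N)}
  have hB : ∀ o, MeasurableSet (B o) := by
    intro o
    have : IsOpen {x : ℝ | |x - shapeOf c o| < δ * N} := isOpen_lt (by fun_prop) (by fun_prop)
    exact (measurableSet_Ici.inter this.measurableSet).compl
  calc _ ≤ (Measure.pi fun i => gammaShape (shapeOf c i)) (⋃ o, Function.eval o ⁻¹' (B o)) := by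
        apply measure_mono
        intro x hx
        by_contra hcon
        apply hx
        apply good_arith hq hδ hδ1 hη hN hc
        intro o
        by_contra ho
        exact hcon (Set.mem_iUnion.2 ⟨o, ho⟩)
    _ ≤ ∑ o, (Measure.pi fun i => gammaShape (shapeOf c i)) (Function.eval o ⁻¹' (B o)) :=
        measure_iUnion_fintype_le _ _
    _ ≤ ∑ o : Option (Fin 2 × Fin 2), ENNReal.ofReal (2 / δ ^ 2 / N) := by
        refine Finset.sum_le_sum fun o _ => ?_
        rw [(measurePreserving_eval (fun i => gammaShape (shapeOf c i)) o).measure_preimage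
          (hB o).nullMeasurableSet]
        refine (gammaShape_cheb (shapeOf_nonneg c o) (by linarith)).trans ?_
        apply ENNReal.ofReal_le_ofReal
        calc shapeOf c o / (δ * N) ^ 2 ≤ (2 * N) / (δ * N) ^ 2 := by gcongr; exact hsh o
          _ = _ := by field_simp
    _ = ENNReal.ofReal (10 / δ ^ 2 / N) := by
        rw [← ENNReal.ofReal_sum_of_nonneg (fun _ _ => by positivity)]
        congr 1
        simp
        ring

lemma accept_of_good {q0 q1 : (Fin 2 × Fin 2) → ℝ} {η : ℝ} (hη : 0 < η)
    (hU : Metric.ball (q0, q1) η ∩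
      (stdSimplex ℝ (Fin 2 × Fin 2) ×ˢ stdSimplex ℝ (Fin 2 × Fin 2)) ⊆ Feas) :
    goodV q0 η ×ˢ goodV q1 η ⊆ {vv | ((SzSet vv.1 ×ˢ SzSet vv.2) ∩ Feas).Nonempty} := by
  have key : ∀ q v, v ∈ goodV q η → (fun j => v (some j) + v none / 4) ∈ SzSet v ∧
      dist (fun j => v (some j) + v none / 4) q < η := by
    intro q v hv
    obtain ⟨h0, h1, h2⟩ := hv
    refine ⟨⟨⟨fun j => ?_, ?_⟩, fun j => ?_⟩, ?_⟩
    · have := h0 (some j); have := h0 none; positivity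
    · rw [Finset.sum_add_distrib, ← h1, Fintype.sum_option]
      simp
      ring
    · have := h0 none
      simp only
      linarith
    · rw [dist_pi_lt_iff hη]
      exact fun j => h2 j
  rintro ⟨v0, v1⟩ ⟨hv0, hv1⟩
  obtain ⟨a0, b0⟩ := key q0 v0 hv0
  obtain ⟨a1, b1⟩ := key q1 v1 hv1
  refine ⟨(_, _), ⟨a0, a1⟩, hU ⟨?_, a0.1, a1.1⟩⟩
  rw [Metric.mem_ball, Prod.dist_eq]
  exact max_lt b0 b1

lemma prod_rect_compl {α β : Type*} [MeasurableSpace α] [MeasurableSpace β] (μ : Measure α)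
    (ν : Measure β) [IsProbabilityMeasure μ] [IsProbabilityMeasure ν] {A : Set α} {B : Set β}
    (hA : MeasurableSet A) (hB : MeasurableSet B) :
    (μ.prod ν) (A ×ˢ B)ᶜ ≤ μ Aᶜ + ν Bᶜ := by
  have : (A ×ˢ B)ᶜ = (Prod.fst ⁻¹' Aᶜ) ∪ (Prod.snd ⁻¹' Bᶜ) := by
    ext x; simp only [Set.mem_compl_iff, Set.mem_prod, Set.mem_union, Set.mem_preimage]; tauto
  rw [this]
  refine (measure_union_le _ _).trans (le_of_eq ?_)
  rw [measurePreserving_fst.measure_preimage hA.compl.nullMeasurableSet,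
    measurePreserving_snd.measure_preimage hB.compl.nullMeasurableSet]

/-- Count tables whose frequencies are `δ`-close to `q`. -/
def goodC (q : (Fin 2 × Fin 2) → ℝ) (δ N : ℝ) : Set ((Fin 2 × Fin 2) → ℕ) :=
  {c | ∀ j, |(c j : ℝ) - N * q j| < δ * N}

lemma multinomial_good {q : (Fin 2 × Fin 2) → ℝ} (hq : q ∈ stdSimplex ℝ (Fin 2 × Fin 2))
    {δ : ℝ} (hδ : 0 < δ) {n : ℕ} (hn : 0 < n) :
    multinomial (Fin 2 × Fin 2) n q (goodC q δ n)ᶜ ≤ ENNReal.ofReal (4 / δ ^ 2 / n) := by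
  have hn' : (0 : ℝ) < n := by exact_mod_cast hn
  have : (goodC q δ n)ᶜ ⊆ ⋃ j, {c | δ * n ≤ |(c j : ℝ) - n * q j|} := by
    intro c hc
    simp only [goodC, Set.mem_compl_iff, Set.mem_ofPred_eq, not_forall, not_lt] at hc
    simpa using hc
  refine (measure_mono this).trans ((measure_iUnion_fintype_le _ _).trans ?_)
  calc _ ≤ ∑ j : Fin 2 × Fin 2, ENNReal.ofReal (1 / δ ^ 2 / n) := by
        refine Finset.sum_le_sum fun j _ => ?_
        refine (multinomial_cheb n hq j (t := δ * n) (by positivity)).trans (le_of_eq ?_)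
        congr 1
        field_simp
    _ = _ := by
        rw [← ENNReal.ofReal_sum_of_nonneg (fun _ _ => by positivity)]
        congr 1
        simp
        ring

/-- **Theorem 1, part 1 (acceptance probability under feasibility).**
Let `N_z ~ Multinomial(n_z, q_z)` be independent for `z ∈ {0,1}` and, given the counts,
let the fiducial randomness be independent `Dirichlet(1, N_z)`.  If `q = (q₀, q₁)` lies in
the interior of the feasibility set `F` (relative to the product of simplices), then the
conditional probability `P*((S₀ × S₁) ∩ F ≠ ∅)` converges to `1` in probability as
`n₀, n₁ → ∞`. -/
theorem acceptProb_tendsto_one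
    (q0 q1 : (Fin 2 × Fin 2) → ℝ)
    (hq0 : q0 ∈ stdSimplex ℝ (Fin 2 × Fin 2)) (hq1 : q1 ∈ stdSimplex ℝ (Fin 2 × Fin 2))
    -- `(q0, q1)` lies in the interior of `F` relative to the product of simplices
    (hint : ∃ U : Set (((Fin 2 × Fin 2) → ℝ) × ((Fin 2 × Fin 2) → ℝ)),
      IsOpen U ∧ (q0, q1) ∈ U ∧
        U ∩ (stdSimplex ℝ (Fin 2 × Fin 2) ×ˢ stdSimplex ℝ (Fin 2 × Fin 2)) ⊆ Feas)
    (n0 n1 : ℕ → ℕ)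
    (hn0 : Tendsto n0 atTop atTop) (hn1 : Tendsto n1 atTop atTop) :
    ∀ ε : ℝ, 0 < ε →
      Tendsto
        (fun n : ℕ =>
          ((multinomial (Fin 2 × Fin 2) (n0 n) q0).prod
            (multinomial (Fin 2 × Fin 2) (n1 n) q1))
            {cc | ε ≤ |1 - (acceptProb cc.1 cc.2).toReal|})
        atTop (𝓝 0) := by
  intro ε hε
  obtain ⟨U, hUo, hqU, hUF⟩ := hint
  obtain ⟨η, hη, hball⟩ := Metric.isOpen_iff.1 hUo _ hqU
  obtain ⟨δ, hδ, hδ1, hδη⟩ : ∃ δ : ℝ, 0 < δ ∧ δ ≤ 1 / 20 ∧ 30 * δ ≤ η :=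
    ⟨min (1 / 20) (η / 30), by positivity, min_le_left _ _, by
      have := min_le_right (1 / 20 : ℝ) (η / 30); linarith⟩
  have hacc := accept_of_good (q0 := q0) (q1 := q1) hη
    ((Set.inter_subset_inter_left _ hball).trans hUF)
  have hr0 : Tendsto (fun n => (n0 n : ℝ)) atTop atTop := tendsto_natCast_atTop_atTop.comp hn0
  have hr1 : Tendsto (fun n => (n1 n : ℝ)) atTop atTop := tendsto_natCast_atTop_atTop.comp hn1
  have hK : ∀ K : ℝ, Tendsto (fun n => K / (n0 n : ℝ) + K / (n1 n : ℝ)) atTop (𝓝 0) := by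
    intro K
    simpa using (hr0.const_div_atTop K).add (hr1.const_div_atTop K)
  have hlim : Tendsto (fun n => ENNReal.ofReal
      (4 / δ ^ 2 / (n0 n : ℝ) + 4 / δ ^ 2 / (n1 n : ℝ))) atTop (𝓝 0) := by
    have := (ENNReal.continuous_ofReal.tendsto 0).comp (hK (4 / δ ^ 2))
    simpa [Function.comp_def] using this
  refine tendsto_of_tendsto_of_tendsto_of_le_of_le' tendsto_const_nhds hlim
    (Eventually.of_forall fun _ => zero_le) ?_
  filter_upwards [(hK (10 / δ ^ 2)).eventually_lt_const hε,
    hr0.eventually_ge_atTop (1 / δ), hr1.eventually_ge_atTop (1 / δ),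
    hn0.eventually_gt_atTop 0, hn1.eventually_gt_atTop 0] with n hsmall hN0 hN1 hp0 hp1
  have hN0' : 1 ≤ δ * (n0 n : ℝ) := by rwa [div_le_iff₀' hδ] at hN0
  have hN1' : 1 ≤ δ * (n1 n : ℝ) := by rwa [div_le_iff₀' hδ] at hN1
  have := multinomial_prob (n0 n) hq0
  have := multinomial_prob (n1 n) hq1
  have hsub : {cc : ((Fin 2 × Fin 2) → ℕ) × ((Fin 2 × Fin 2) → ℕ) |
      ε ≤ |1 - (acceptProb cc.1 cc.2).toReal|} ⊆
      (goodC q0 δ (n0 n) ×ˢ goodC q1 δ (n1 n))ᶜ := by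
    rintro ⟨c0, c1⟩ hcc ⟨hg0, hg1⟩
    have d0 := dirichlet_good hq0 hδ hδ1 hδη hN0' hg0
    have d1 := dirichlet_good hq1 hδ hδ1 hδη hN1' hg1
    set P := (dirichlet (shapeOf c0)).prod (dirichlet (shapeOf c1)) with hP
    have hm : MeasurableSet (goodV q0 η ×ˢ goodV q1 η) :=
      (measurableSet_goodV q0 η).prod (measurableSet_goodV q1 η)
    have hcompl : P (goodV q0 η ×ˢ goodV q1 η)ᶜ ≤
        ENNReal.ofReal (10 / δ ^ 2 / (n0 n : ℝ) + 10 / δ ^ 2 / (n1 n : ℝ)) := by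
      rw [ENNReal.ofReal_add (by positivity) (by positivity)]
      exact (prod_rect_compl _ _ (measurableSet_goodV q0 η) (measurableSet_goodV q1 η)).trans
        (add_le_add d0 d1)
    have h1 : P.real (goodV q0 η ×ˢ goodV q1 η)ᶜ ≤
        10 / δ ^ 2 / (n0 n : ℝ) + 10 / δ ^ 2 / (n1 n : ℝ) :=
      ENNReal.toReal_le_of_le_ofReal (by positivity) hcompl
    rw [probReal_compl_eq_one_sub hm] at h1
    have h2 : P.real (goodV q0 η ×ˢ goodV q1 η) ≤ (acceptProb c0 c1).toReal :=
      measureReal_mono hacc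
    have h3 : (acceptProb c0 c1).toReal ≤ 1 := measureReal_le_one (μ := P)
    simp only [Set.mem_ofPred_eq] at hcc
    rw [abs_of_nonneg (by linarith)] at hcc
    linarith
  refine (measure_mono hsub).trans ((prod_rect_compl _ _ (Set.to_countable _).measurableSet
    (Set.to_countable _).measurableSet).trans ?_)
  rw [ENNReal.ofReal_add (by positivity) (by positivity)]
  exact add_le_add (multinomial_good hq0 hδ hp0) (multinomial_good hq1 hδ hp1)
end

section
/- Let N_z be independent Multinomial(n_z, q_z) for z in {0,1} and suppose n_z/(n_0+n_1) converges to λ_z in (0,1). For each point q̄ = (q̄_0, q̄_1) of the feasibility set F define g(q̄) as the minimum of a continuously differentiable objective f(p_{00,00},...,p_{11,11}) over nonnegative p summing to 1 and satisfying the eight linear identities linking q̄ to p. Assume there is an open set Q with q = (q_0,q_1) in Q, Q contained in F, on which g is continuously differentiable. Then sqrt(n_0+n_1) * ( g(N_0/n_0, N_1/n_1) - g(q) ) converges in distribution to N(0, σ^2), where σ^2 = sum over z in {0,1} of λ_z^{-1} [ sum over a,y of (∂g(q)/∂q_{zay})^2 q_{zay} - ( sum over a,y of (∂g(q)/∂q_{zay})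 q_{zay} )^2 ]. -/
open MeasureTheory ProbabilityTheory Filter Matrix
open scoped ENNReal NNReal Topology BoundedContinuousFunction

/-- The constraint set for the optimization defining the bound: nonnegative
counterfactual probabilities summing to one and linked to `(q0, q1)` by the eight
identities. -/
def constrSet (q0 q1 : (Fin 2 × Fin 2) → ℝ) :
    Set (Fin 2 → Fin 2 → Fin 2 → Fin 2 → ℝ) :=
  {p | (∀ i j k l, 0 ≤ p i j k l) ∧
    (∑ i : Fin 2, ∑ j : Fin 2, ∑ k : Fin 2, ∑ l : Fin 2, p i j k l) = 1 ∧
    linkEqs p q0 q1}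

/-- The value function `g(q̄)`: the minimum of the objective `f` over the constraint
set determined by `q̄`. -/
noncomputable def gval (f : (Fin 2 → Fin 2 → Fin 2 → Fin 2 → ℝ) → ℝ)
    (qq : ((Fin 2 × Fin 2) → ℝ) × ((Fin 2 × Fin 2) → ℝ)) : ℝ :=
  sInf (f '' constrSet qq.1 qq.2)

set_option linter.unusedSectionVars false

section OneSample

variable {ι : Type*} [Fintype ι] [DecidableEq ι] [MeasurableSpace ι] [MeasurableSingletonClass ι]

lemma categorical_isProb {q : ι → ℝ} (hq : q ∈ stdSimplex ℝ ι) :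
    IsProbabilityMeasure (categorical q) := by
  constructor
  simp only [categorical, Measure.coe_finsetSum, Finset.sum_apply, Measure.smul_apply,
    measure_univ, smul_eq_mul, mul_one]
  rw [← ENNReal.ofReal_sum_of_nonneg (fun i _ => hq.1 i), hq.2, ENNReal.ofReal_one]

lemma integral_categorical {q : ι → ℝ} (hq : q ∈ stdSimplex ℝ ι) (d : ι → ℝ) :
    ∫ x, d x ∂(categorical q) = ∑ j, d j * q j := by
  unfold categorical
  rw [integral_finsetSum_measure]
  · refine Finset.sum_congr rfl fun j _ => ?_
    rw [integral_smul_measure, integral_dirac, ENNReal.toReal_ofReal (hq.1 j), smul_eq_mul, mul_comm]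
  · intro i _
    exact (integrable_dirac (by simp)).smul_measure (by simp)

/-- counts of the first `n` entries -/
def cnt (n : ℕ) (ω : ℕ → ι) (j : ι) : ℕ := (Finset.univ.filter (fun i : Fin n => ω i = j)).card

lemma measurable_cnt (n : ℕ) : Measurable (cnt n : (ℕ → ι) → (ι → ℕ)) := by
  have h1 : Measurable (fun (x : Fin n → ι) (j : ι) =>
      (Finset.univ.filter (fun i => x i = j)).card) := measurable_of_countable _
  have h2 : Measurable (fun (ω : ℕ → ι) (i : Fin n) => ω i) := by fun_prop
  exact h1.comp h2

lemma multinomial_eq_map {q : ι → ℝ} [IsProbabilityMeasure (categorical q)] (n : ℕ) :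
    multinomial ι n q = (Measure.infinitePi fun _ : ℕ => categorical q).map (cnt n) := by
  have h1 : Measurable (fun (x : Fin n → ι) (j : ι) =>
      (Finset.univ.filter (fun i => x i = j)).card) := measurable_of_countable _
  have h2 : Measurable (fun (ω : ℕ → ι) (i : Fin n) => ω i) := by fun_prop
  have hind : iIndepFun (fun (i : ℕ) (ω : ℕ → ι) => ω i)
      (Measure.infinitePi fun _ : ℕ => categorical q) :=
    iIndepFun_infinitePi (X := fun _ x => x) (by fun_prop)
  have h3 := (iIndepFun_iff_map_fun_eq_pi_map
    (fun i => (measurable_pi_apply _).aemeasurable)).1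
    (hind.precomp (Fin.val_injective (n := n)))
  simp only [Measure.infinitePi_map_eval] at h3
  rw [multinomial, ← h3, Measure.map_map h1 h2]
  rfl

lemma sum_cnt (d : ι → ℝ) (n : ℕ) (ω : ℕ → ι) :
    ∑ j, d j * (cnt n ω j : ℝ) = ∑ k ∈ Finset.range n, d (ω k) := by
  rw [Finset.sum_range]
  simp only [cnt, Finset.card_eq_sum_ones, Finset.sum_filter, Nat.cast_sum, Nat.cast_ite,
    Nat.cast_one, Nat.cast_zero, Finset.mul_sum]
  rw [Finset.sum_comm]
  simp

lemma cnt_simplex {n : ℕ} (hn : 0 < n) (ω : ℕ → ι) :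
    (fun j => (cnt n ω j : ℝ) / n) ∈ stdSimplex ℝ ι := by
  refine ⟨fun j => by positivity, ?_⟩
  have := sum_cnt (fun _ => 1) n ω
  simp only [one_mul, Finset.sum_const, Finset.card_range, nsmul_eq_mul, mul_one] at this
  rw [← Finset.sum_div, this]
  field_simp

lemma memLp_coord {q : ι → ℝ} [IsProbabilityMeasure (categorical q)] (d : ι → ℝ) (k : ℕ) :
    MemLp (fun ω : ℕ → ι => d (ω k)) 2 (Measure.infinitePi fun _ : ℕ => categorical q) := by
  have hm : Measurable d := measurable_of_countable _
  refine MemLp.of_bound (hm.comp (measurable_pi_apply k)).aestronglyMeasurable (∑ j, ‖d j‖) (ae_of_all _ fun ω => ?_)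
  exact Finset.single_le_sum (f := fun j => ‖d j‖) (fun _ _ => norm_nonneg _) (Finset.mem_univ _)

lemma integral_coord {q : ι → ℝ} (hq : q ∈ stdSimplex ℝ ι) [IsProbabilityMeasure (categorical q)]
    (d : ι → ℝ) (k : ℕ) :
    ∫ ω : ℕ → ι, d (ω k) ∂(Measure.infinitePi fun _ : ℕ => categorical q) = ∑ j, d j * q j := by
  have hm : Measurable d := measurable_of_countable _
  have h := (measurePreserving_eval_infinitePi (fun _ : ℕ => categorical q) k)
  have h2 := integral_map (μ := Measure.infinitePi fun _ : ℕ => categorical q) (f := d) h.measurable.aemeasurable hm.aestronglyMeasurable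
  rw [h.map_eq, integral_categorical hq] at h2
  exact h2.symm

lemma variance_coord {q : ι → ℝ} (hq : q ∈ stdSimplex ℝ ι) [IsProbabilityMeasure (categorical q)]
    (d : ι → ℝ) (k : ℕ) :
    Var[fun ω : ℕ → ι => d (ω k); Measure.infinitePi fun _ : ℕ => categorical q] =
      ∑ j, d j ^ 2 * q j - (∑ j, d j * q j) ^ 2 := by
  rw [variance_eq_sub (memLp_coord d k), integral_coord hq d k]
  congr 1
  exact integral_coord hq (fun j => d j ^ 2) k

lemma indep_coord {q : ι → ℝ} [IsProbabilityMeasure (categorical q)] (d : ι → ℝ) :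
    iIndepFun (fun (k : ℕ) (ω : ℕ → ι) => d (ω k))
      (Measure.infinitePi fun _ : ℕ => categorical q) :=
  iIndepFun_infinitePi (X := fun _ x => d x) (fun _ => measurable_of_countable _)

lemma ident_coord {q : ι → ℝ} [IsProbabilityMeasure (categorical q)] (d : ι → ℝ) (k : ℕ) :
    IdentDistrib (fun (ω : ℕ → ι) => d (ω k)) (fun (ω : ℕ → ι) => d (ω 0))
      (Measure.infinitePi fun _ : ℕ => categorical q)
      (Measure.infinitePi fun _ : ℕ => categorical q) := by
  have hm : Measurable d := measurable_of_countable _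
  refine IdentDistrib.comp (u := d) ⟨(measurable_pi_apply k).aemeasurable, (measurable_pi_apply 0).aemeasurable, ?_⟩ hm
  simp [Measure.infinitePi_map_eval]

/-- scaled centred linear statistic -/
noncomputable def lin (q d : ι → ℝ) (n : ℕ) (ω : ℕ → ι) : ℝ :=
  ∑ j, d j * ((cnt n ω j : ℝ) / n - q j)

lemma lin_eq (q d : ι → ℝ) {n : ℕ} (hn : 0 < n) (ω : ℕ → ι) :
    lin q d n ω = (n : ℝ)⁻¹ * (∑ k ∈ Finset.range n, d (ω k) - n * ∑ j, d j * q j) := by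
  have : (n : ℝ) ≠ 0 := by positivity
  rw [← sum_cnt, lin, mul_sub, ← mul_assoc, inv_mul_cancel₀ this, one_mul, Finset.mul_sum,
    ← Finset.sum_sub_distrib]
  refine Finset.sum_congr rfl fun j _ => ?_
  field_simp

lemma measurable_lin (q d : ι → ℝ) (n : ℕ) : Measurable (lin q d n) := by
  have h : Measurable (fun c : ι → ℕ => ∑ j, d j * ((c j : ℝ) / n - q j)) :=
    measurable_of_countable _
  exact h.comp (measurable_cnt n)

lemma clt_one {q : ι → ℝ} (hq : q ∈ stdSimplex ℝ ι) [IsProbabilityMeasure (categorical q)]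
    (d : ι → ℝ) :
    TendstoInDistribution (fun (n : ℕ) ω => √(n : ℝ) * lin q d n ω) atTop (id : ℝ → ℝ)
      (fun _ => Measure.infinitePi fun _ : ℕ => categorical q)
      (gaussianReal 0 (∑ j, d j ^ 2 * q j - (∑ j, d j * q j) ^ 2).toNNReal) := by
  have h := tendstoInDistribution_inv_sqrt_mul_sum_sub
    (P' := gaussianReal 0 (∑ j, d j ^ 2 * q j - (∑ j, d j * q j) ^ 2).toNNReal) (Y := id)
    (X := fun (k : ℕ) (ω : ℕ → ι) => d (ω k))
    (P := Measure.infinitePi fun _ : ℕ => categorical q)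
    (by rw [variance_coord hq]; exact HasLaw.id) (memLp_coord d 0) (indep_coord d) (ident_coord d)
  refine h.congr (fun n => ae_of_all _ fun ω => ?_) (ae_of_all _ fun _ => rfl)
  dsimp only
  rw [integral_coord hq]
  rcases Nat.eq_zero_or_pos n with rfl | hn
  · simp
  · rw [lin_eq q d hn, ← mul_assoc]
    congr 1
    have : (0 : ℝ) < n := by positivity
    have h2 := Real.sq_sqrt this.le
    have h3 : √(n : ℝ) ≠ 0 := by positivity
    field_simp
    exact h2.symm

lemma cheb_one {q : ι → ℝ} (hq : q ∈ stdSimplex ℝ ι) [IsProbabilityMeasure (categorical q)]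
    (j : ι) {n : ℕ} (hn : 0 < n) {c : ℝ} (hc : 0 < c) :
    (Measure.infinitePi fun _ : ℕ => categorical q) {ω | c ≤ |(cnt n ω j : ℝ) / n - q j|} ≤
      ENNReal.ofReal (1 / (n * c ^ 2)) := by
  set P := Measure.infinitePi fun _ : ℕ => categorical q
  set d : ι → ℝ := Pi.single j 1 with hd
  have hn' : (0 : ℝ) < n := by positivity
  have hL : ∀ k ∈ Finset.range n, MemLp (fun ω : ℕ → ι => d (ω k)) 2 P :=
    fun k _ => memLp_coord d k
  have hsum : MemLp (∑ k ∈ Finset.range n, fun ω : ℕ → ι => d (ω k)) 2 P := memLp_finsetSum' _ hL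
  have hv := IndepFun.variance_sum hL (fun a _ b _ hab => (indep_coord (q := q) d).indepFun hab)
  have hm : ∑ j, d j * q j = q j := by simp [hd, Pi.single_apply]
  have hv1 : ∀ k ∈ Finset.range n, Var[fun ω : ℕ → ι => d (ω k); P] ≤ 1 := by
    intro k _
    rw [variance_coord hq, hm]
    have : ∑ i, d i ^ 2 * q i = q j := by simp [hd, Pi.single_apply]
    rw [this]
    have h1 := hq.1 j
    have h2 : q j ≤ 1 := hq.2 ▸ Finset.single_le_sum (fun i _ => hq.1 i) (Finset.mem_univ j)
    nlinarith
  have hv2 := Finset.sum_le_sum hv1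
  rw [← hv] at hv2
  simp only [Finset.sum_const, Finset.card_range, nsmul_eq_mul, mul_one] at hv2
  have he : P[∑ k ∈ Finset.range n, fun ω : ℕ → ι => d (ω k)] = n * q j := by
    simp only [Finset.sum_apply]
    rw [integral_finsetSum _ (fun k hk => (hL k hk).integrable (by norm_num))]
    simp only [P, integral_coord hq, hm, Finset.sum_const, Finset.card_range, nsmul_eq_mul]
  have h := meas_ge_le_variance_div_sq hsum (c := n * c) (by positivity)
  rw [he] at h
  refine (measure_mono ?_).trans (h.trans (ENNReal.ofReal_le_ofReal ?_))
  · intro ω hω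
    simp only [Set.mem_ofPred_eq, Finset.sum_apply] at hω ⊢
    rw [← sum_cnt d]
    have : ∑ i, d i * (cnt n ω i : ℝ) = cnt n ω j := by simp [hd, Pi.single_apply]
    rw [this]
    have h5 : (cnt n ω j : ℝ) - n * q j = n * ((cnt n ω j : ℝ) / n - q j) := by field_simp
    rw [h5, abs_mul, abs_of_pos hn']
    gcongr
  · calc _ ≤ (n : ℝ) / (n * c) ^ 2 := by gcongr
      _ = _ := by field_simp

end OneSample

section TwoSample

variable {ι : Type*} [Fintype ι] [DecidableEq ι] [MeasurableSpace ι] [MeasurableSingletonClass ι]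

lemma clt_scaled {q : ι → ℝ} (hq : q ∈ stdSimplex ℝ ι) [IsProbabilityMeasure (categorical q)]
    (d : ι → ℝ) (m : ℕ → ℕ) (hm : Tendsto m atTop atTop) (a : ℕ → ℝ) (a0 : ℝ)
    (ha : Tendsto a atTop (𝓝 a0)) (t : ℝ) :
    Tendsto (fun n => charFun ((Measure.infinitePi fun _ : ℕ => categorical q).map
      (fun ω => a n * (√(m n : ℝ) * lin q d (m n) ω))) t) atTop
      (𝓝 (Complex.exp (-((a0 ^ 2 * (∑ j, d j ^ 2 * q j - (∑ j, d j * q j) ^ 2) : ℝ) : ℂ)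
        * t ^ 2 / 2))) := by
  set P := Measure.infinitePi fun _ : ℕ => categorical q with hP
  set v := ∑ j, d j ^ 2 * q j - (∑ j, d j * q j) ^ 2 with hv
  have hv0 : 0 ≤ v := by rw [hv, ← variance_coord hq d 0]; exact variance_nonneg _ _
  have h1 : TendstoInDistribution (fun (n : ℕ) ω => √(m n : ℝ) * lin q d (m n) ω) atTop
      (id : ℝ → ℝ) (fun _ => P) (gaussianReal 0 v.toNNReal) :=
    ⟨fun n => (clt_one hq d).forall_aemeasurable (m n), by fun_prop,
      (clt_one hq d).tendsto.comp hm⟩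
  have h2 : TendstoInMeasure P (fun n (_ : ℕ → ι) => a n) atTop (fun _ => a0) :=
    tendstoInMeasure_of_tendsto_ae (fun n => aestronglyMeasurable_const) (ae_of_all _ fun _ => ha)
  have h3 := h1.continuous_comp_prodMk_of_tendstoInMeasure_const
    (g := fun x : ℝ × ℝ => x.2 * x.1) (by fun_prop) h2 (fun n => aemeasurable_const)
  have h4 := ProbabilityMeasure.tendsto_iff_tendsto_charFun.1 h3.tendsto t
  simp only [ProbabilityMeasure.coe_mk, id] at h4
  convert! h4 using 2
  rw [gaussianReal_map_const_mul, charFun_gaussianReal]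
  congr 1
  simp only [mul_zero, NNReal.coe_mul, Real.coe_toNNReal _ hv0]
  push_cast
  simp
  ring

lemma clt_two {q0 q1 : ι → ℝ} (hq0 : q0 ∈ stdSimplex ℝ ι) (hq1 : q1 ∈ stdSimplex ℝ ι)
    [IsProbabilityMeasure (categorical q0)] [IsProbabilityMeasure (categorical q1)]
    (d0 d1 : ι → ℝ) (m0 m1 : ℕ → ℕ) (hm0 : Tendsto m0 atTop atTop)
    (hm1 : Tendsto m1 atTop atTop) (a b : ℕ → ℝ) (a0 b0 : ℝ)
    (ha : Tendsto a atTop (𝓝 a0)) (hb : Tendsto b atTop (𝓝 b0)) :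
    TendstoInDistribution (fun n (ω : (ℕ → ι) × (ℕ → ι)) =>
        a n * (√(m0 n : ℝ) * lin q0 d0 (m0 n) ω.1) + b n * (√(m1 n : ℝ) * lin q1 d1 (m1 n) ω.2))
      atTop (id : ℝ → ℝ)
      (fun _ => (Measure.infinitePi fun _ : ℕ => categorical q0).prod
        (Measure.infinitePi fun _ : ℕ => categorical q1))
      (gaussianReal 0 (a0 ^ 2 * (∑ j, d0 j ^ 2 * q0 j - (∑ j, d0 j * q0 j) ^ 2) +
        b0 ^ 2 * (∑ j, d1 j ^ 2 * q1 j - (∑ j, d1 j * q1 j) ^ 2)).toNNReal) := by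
  have hX : ∀ n, Measurable (fun ω => a n * (√(m0 n : ℝ) * lin q0 d0 (m0 n) ω)) := fun n =>
    ((measurable_lin _ _ _).const_mul _).const_mul _
  have hY : ∀ n, Measurable (fun ω => b n * (√(m1 n : ℝ) * lin q1 d1 (m1 n) ω)) := fun n =>
    ((measurable_lin _ _ _).const_mul _).const_mul _
  have hv0 : 0 ≤ ∑ j, d0 j ^ 2 * q0 j - (∑ j, d0 j * q0 j) ^ 2 := by
    rw [← variance_coord hq0 d0 0]; exact variance_nonneg _ _
  have hv1 : 0 ≤ ∑ j, d1 j ^ 2 * q1 j - (∑ j, d1 j * q1 j) ^ 2 := by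
    rw [← variance_coord hq1 d1 0]; exact variance_nonneg _ _
  refine ⟨fun n => (((hX n).comp measurable_fst).add ((hY n).comp measurable_snd)).aemeasurable,
    by fun_prop, ProbabilityMeasure.tendsto_iff_tendsto_charFun.2 fun t => ?_⟩
  have h := (clt_scaled hq0 d0 m0 hm0 a a0 ha t).mul (clt_scaled hq1 d1 m1 hm1 b b0 hb t)
  simp only [ProbabilityMeasure.coe_mk, Measure.map_id]
  convert! h using 2
  · rename_i n
    rw [IndepFun.charFun_map_fun_add_eq_mul
      (X := fun ω : (ℕ → ι) × (ℕ → ι) => a n * (√(m0 n : ℝ) * lin q0 d0 (m0 n) ω.1))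
      (Y := fun ω : (ℕ → ι) × (ℕ → ι) => b n * (√(m1 n : ℝ) * lin q1 d1 (m1 n) ω.2))
      ((hX n).comp measurable_fst).aemeasurable ((hY n).comp measurable_snd).aemeasurable
      (indepFun_prod (hX n) (hY n)), Pi.mul_apply]
    congr 2
    · rw [← measurePreserving_fst (μ := Measure.infinitePi fun _ : ℕ => categorical q0)
        (ν := Measure.infinitePi fun _ : ℕ => categorical q1) |>.map_eq,
        Measure.map_map (hX n) measurable_fst]
      simp [Function.comp_def]
    · rw [← measurePreserving_snd (μ := Measure.infinitePi fun _ : ℕ => categorical q0)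
        (ν := Measure.infinitePi fun _ : ℕ => categorical q1) |>.map_eq,
        Measure.map_map (hY n) measurable_snd]
      simp [Function.comp_def]
  · rw [charFun_gaussianReal, ← Complex.exp_add, Real.coe_toNNReal _ (by positivity)]
    congr 1
    push_cast
    ring

end TwoSample

section Remainder

variable {ι : Type*} [Fintype ι] [DecidableEq ι] [MeasurableSpace ι] [MeasurableSingletonClass ι]

/-- the pair of empirical frequencies -/
noncomputable def freq (k0 k1 : ℕ) (ω : (ℕ → ι) × (ℕ → ι)) : (ι → ℝ) × (ι → ℝ) :=
  (fun j => (cnt k0 ω.1 j : ℝ) / k0, fun j => (cnt k1 ω.2 j : ℝ) / k1)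

lemma cheb_two {q0 q1 : ι → ℝ} (hq0 : q0 ∈ stdSimplex ℝ ι) (hq1 : q1 ∈ stdSimplex ℝ ι)
    [IsProbabilityMeasure (categorical q0)] [IsProbabilityMeasure (categorical q1)]
    {k0 k1 : ℕ} (h0 : 0 < k0) (h1 : 0 < k1) {c : ℝ} (hc : 0 < c) :
    ((Measure.infinitePi fun _ : ℕ => categorical q0).prod
        (Measure.infinitePi fun _ : ℕ => categorical q1))
      {ω | c ≤ ‖freq k0 k1 ω - (q0, q1)‖} ≤
    ENNReal.ofReal (Fintype.card ι * (1 / (k0 * c ^ 2) + 1 / (k1 * c ^ 2))) := by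
  set P0 := Measure.infinitePi fun _ : ℕ => categorical q0
  set P1 := Measure.infinitePi fun _ : ℕ => categorical q1
  have hsub : {ω | c ≤ ‖freq k0 k1 ω - (q0, q1)‖} ⊆
      (⋃ j, Prod.fst ⁻¹' {ω : ℕ → ι | c ≤ |(cnt k0 ω j : ℝ) / k0 - q0 j|}) ∪
      (⋃ j, Prod.snd ⁻¹' {ω : ℕ → ι | c ≤ |(cnt k1 ω j : ℝ) / k1 - q1 j|}) := by
    intro ω hω
    by_contra hcon
    simp only [Set.mem_union, Set.mem_iUnion, Set.mem_preimage, Set.mem_ofPred_eq, not_or,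
      not_exists, not_le] at hcon hω
    refine absurd hω (not_le.2 ?_)
    rw [Prod.norm_def, max_lt_iff, pi_norm_lt_iff hc, pi_norm_lt_iff hc]
    exact hcon
  have hm : ∀ (k : ℕ) (r : ℝ) (j : ι),
      MeasurableSet {ω : ℕ → ι | c ≤ |(cnt k ω j : ℝ) / k - r|} := fun k r j =>
    measurable_cnt k (MeasurableSet.of_discrete (s := {x : ι → ℕ | c ≤ |(x j : ℝ) / k - r|}))
  have hb0 : ∀ j, (P0.prod P1) (Prod.fst ⁻¹' {ω : ℕ → ι | c ≤ |(cnt k0 ω j : ℝ) / k0 - q0 j|}) ≤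
      ENNReal.ofReal (1 / (k0 * c ^ 2)) := fun j => by
    rw [(measurePreserving_fst (μ := P0) (ν := P1)).measure_preimage (hm _ _ _).nullMeasurableSet]
    exact cheb_one hq0 j h0 hc
  have hb1 : ∀ j, (P0.prod P1) (Prod.snd ⁻¹' {ω : ℕ → ι | c ≤ |(cnt k1 ω j : ℝ) / k1 - q1 j|}) ≤
      ENNReal.ofReal (1 / (k1 * c ^ 2)) := fun j => by
    rw [(measurePreserving_snd (μ := P0) (ν := P1)).measure_preimage (hm _ _ _).nullMeasurableSet]
    exact cheb_one hq1 j h1 hc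
  refine (measure_mono hsub).trans ((measure_union_le _ _).trans ?_)
  rw [mul_add, ENNReal.ofReal_add (by positivity) (by positivity),
    ENNReal.ofReal_mul (by positivity), ENNReal.ofReal_mul (by positivity), ENNReal.ofReal_natCast]
  refine add_le_add ?_ ?_
  · refine (measure_iUnion_fintype_le _ _).trans ((Finset.sum_le_sum fun j _ => hb0 j).trans ?_)
    simp
  · refine (measure_iUnion_fintype_le _ _).trans ((Finset.sum_le_sum fun j _ => hb1 j).trans ?_)
    simp

lemma fderiv_decomp (A : ((ι → ℝ) × (ι → ℝ)) →L[ℝ] ℝ) (u w : ι → ℝ) :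
    A (u, w) = ∑ j, A (Pi.single j 1, 0) * u j + ∑ j, A (0, Pi.single j 1) * w j := by
  have hu : (u, (0 : ι → ℝ)) = ∑ j, u j • ((Pi.single j 1, 0) : (ι → ℝ) × (ι → ℝ)) := by
    ext i <;> simp [Prod.fst_sum, Prod.snd_sum, Finset.sum_apply, Pi.single_apply]
  have hw : ((0 : ι → ℝ), w) = ∑ j, w j • ((0, Pi.single j 1) : (ι → ℝ) × (ι → ℝ)) := by
    ext i <;> simp [Prod.fst_sum, Prod.snd_sum, Finset.sum_apply, Pi.single_apply]
  have : (u, w) = (u, (0 : ι → ℝ)) + ((0 : ι → ℝ), w) := by simp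
  rw [this, map_add, hu, hw, map_sum, map_sum]
  simp only [map_smul, smul_eq_mul, mul_comm]

end Remainder

/-- **Theorem 2, part 1 (CLT for the plug-in bound).**
Let `N_z ~ Multinomial(n_z, q_z)` independently for `z ∈ {0,1}` with
`n_z / (n₀ + n₁) → λ_z ∈ (0,1)`.  Let `g` be the value function of the constrained
minimization of a continuously differentiable objective `f`, and suppose that on an open
set `U ∋ q = (q₀, q₁)` whose trace on the product of simplices is contained in the
feasibility set `F`, `g` agrees with a function `G` that is continuously differentiable
on `U` (this is the meaning of `g` being continuously differentiable on the relatively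
open set `Q = U ∩ (Δ³ × Δ³) ⊆ F`).  Then
`√(n₀ + n₁) (g(N₀/n₀, N₁/n₁) - g(q))` converges in distribution to `N(0, σ²)`, where
`σ² = ∑_z λ_z⁻¹ [ ∑_{a,y} (∂g/∂q_{zay})² q_{zay} - ( ∑_{a,y} (∂g/∂q_{zay}) q_{zay} )² ]`. -/
theorem value_function_clt
    (q0 q1 : (Fin 2 × Fin 2) → ℝ)
    (hq0 : q0 ∈ stdSimplex ℝ (Fin 2 × Fin 2)) (hq1 : q1 ∈ stdSimplex ℝ (Fin 2 × Fin 2))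
    (f : (Fin 2 → Fin 2 → Fin 2 → Fin 2 → ℝ) → ℝ) (hf : ContDiff ℝ 1 f)
    (G : ((Fin 2 × Fin 2) → ℝ) × ((Fin 2 × Fin 2) → ℝ) → ℝ)
    (U : Set (((Fin 2 × Fin 2) → ℝ) × ((Fin 2 × Fin 2) → ℝ)))
    (hU : IsOpen U) (hqU : (q0, q1) ∈ U)
    (hUF : U ∩ (stdSimplex ℝ (Fin 2 × Fin 2) ×ˢ stdSimplex ℝ (Fin 2 × Fin 2)) ⊆ Feas)
    (hGg : ∀ qq ∈ U ∩ (stdSimplex ℝ (Fin 2 × Fin 2) ×ˢ stdSimplex ℝ (Fin 2 × Fin 2)),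
      G qq = gval f qq)
    (hG : ContDiffOn ℝ 1 G U)
    (n0 n1 : ℕ → ℕ)
    (hn0 : Tendsto n0 atTop atTop) (hn1 : Tendsto n1 atTop atTop)
    (lam0 lam1 : ℝ) (hlam0 : lam0 ∈ Set.Ioo (0 : ℝ) 1) (hlam1 : lam1 ∈ Set.Ioo (0 : ℝ) 1)
    (hratio0 : Tendsto (fun n : ℕ => (n0 n : ℝ) / ((n0 n : ℝ) + (n1 n : ℝ))) atTop (𝓝 lam0))
    (hratio1 : Tendsto (fun n : ℕ => (n1 n : ℝ) / ((n0 n : ℝ) + (n1 n : ℝ))) atTop (𝓝 lam1))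
    -- the partial derivatives `∂g/∂q_{zay}` at `q`
    (D : Fin 2 → (Fin 2 × Fin 2) → ℝ)
    (hD : ∀ z ay, D z ay = fderiv ℝ G (q0, q1)
      (if z = 0 then ((Pi.single ay 1 : (Fin 2 × Fin 2) → ℝ), 0)
       else (0, (Pi.single ay 1 : (Fin 2 × Fin 2) → ℝ))))
    (σ2 : ℝ)
    (hσ2 : σ2 = ∑ z : Fin 2, (if z = 0 then lam0 else lam1)⁻¹ *
      ((∑ ay : Fin 2 × Fin 2, (D z ay) ^ 2 * (if z = 0 then q0 else q1) ay)
        - (∑ ay : Fin 2 × Fin 2, D z ay * (if z = 0 then q0 else q1) ay) ^ 2)) :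
    ∀ h : ℝ →ᵇ ℝ,
      Tendsto
        (fun n : ℕ =>
          ∫ cc,
            h (Real.sqrt ((n0 n : ℝ) + (n1 n : ℝ)) *
              (gval f (fun ay => (cc.1 ay : ℝ) / (n0 n : ℝ),
                       fun ay => (cc.2 ay : ℝ) / (n1 n : ℝ))
                - gval f (q0, q1)))
          ∂((multinomial (Fin 2 × Fin 2) (n0 n) q0).prod
              (multinomial (Fin 2 × Fin 2) (n1 n) q1)))
        atTop
        (𝓝 (∫ x, h x ∂(gaussianReal 0 σ2.toNNReal))) := by
  intro h
  have : IsProbabilityMeasure (categorical q0) := categorical_isProb hq0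
  have : IsProbabilityMeasure (categorical q1) := categorical_isProb hq1
  set P0 := Measure.infinitePi fun _ : ℕ => categorical q0 with hP0
  set P1 := Measure.infinitePi fun _ : ℕ => categorical q1 with hP1
  set N : ℕ → ℝ := fun n => (n0 n : ℝ) + (n1 n : ℝ) with hN
  have hpos0 : ∀ᶠ n in atTop, 0 < n0 n := hn0.eventually_gt_atTop 0
  have hpos1 : ∀ᶠ n in atTop, 0 < n1 n := hn1.eventually_gt_atTop 0
  have hr0 : Tendsto (fun n => N n / n0 n) atTop (𝓝 lam0⁻¹) := by
    simpa [hN] using hratio0.inv₀ hlam0.1.ne'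
  have hr1 : Tendsto (fun n => N n / n1 n) atTop (𝓝 lam1⁻¹) := by
    simpa [hN] using hratio1.inv₀ hlam1.1.ne'
  have hNtop : Tendsto N atTop atTop :=
    tendsto_atTop_mono (fun n => by simp [hN]) (tendsto_natCast_atTop_atTop.comp hn0)
  have hD0 : ∀ j, D 0 j = fderiv ℝ G (q0, q1) (Pi.single j 1, 0) := fun j => by
    simpa using hD 0 j
  have hD1 : ∀ j, D 1 j = fderiv ℝ G (q0, q1) (0, Pi.single j 1) := fun j => by
    simpa using hD 1 j
  -- the linear part
  have hclt := clt_two hq0 hq1 (D 0) (D 1) n0 n1 hn0 hn1 (fun n => √(N n / n0 n))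
    (fun n => √(N n / n1 n)) _ _ hr0.sqrt hr1.sqrt
  have hσ : √lam0⁻¹ ^ 2 * (∑ j, D 0 j ^ 2 * q0 j - (∑ j, D 0 j * q0 j) ^ 2) +
        √lam1⁻¹ ^ 2 * (∑ j, D 1 j ^ 2 * q1 j - (∑ j, D 1 j * q1 j) ^ 2) = σ2 := by
    rw [hσ2, Fin.sum_univ_two, Real.sq_sqrt (inv_nonneg.2 hlam0.1.le),
      Real.sq_sqrt (inv_nonneg.2 hlam1.1.le)]
    simp
  rw [hσ] at hclt
  -- the statistic itself
  set Φ : ℕ → ((Fin 2 × Fin 2) → ℕ) × ((Fin 2 × Fin 2) → ℕ) → ℝ := fun n cc =>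
    √(N n) * (gval f (fun ay => (cc.1 ay : ℝ) / (n0 n : ℝ),
      fun ay => (cc.2 ay : ℝ) / (n1 n : ℝ)) - gval f (q0, q1)) with hΦ
  have hΦm : ∀ n, Measurable (Φ n) := fun n => measurable_of_countable _
  have hcm : ∀ n, Measurable (Prod.map (cnt (n0 n)) (cnt (n1 n)) :
      (ℕ → Fin 2 × Fin 2) × (ℕ → Fin 2 × Fin 2) → _) := fun n =>
    (measurable_cnt _).prodMap (measurable_cnt _)
  have hdiff : HasFDerivAt G (fderiv ℝ G (q0, q1)) (q0, q1) :=
    ((hG.differentiableOn one_ne_zero).differentiableAt (hU.mem_nhds hqU)).hasFDerivAt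
  have hGq : G (q0, q1) = gval f (q0, q1) := hGg _ ⟨hqU, hq0, hq1⟩
  have hkey : TendstoInDistribution
      (fun n => Φ n ∘ Prod.map (cnt (n0 n)) (cnt (n1 n))) atTop (id : ℝ → ℝ)
      (fun _ => P0.prod P1) (gaussianReal 0 σ2.toNNReal) := by
    refine tendstoInDistribution_of_tendstoInMeasure_sub _ _ hclt ?_
      (fun n => ((hΦm n).comp (hcm n)).aemeasurable)
    rw [tendstoInMeasure_iff_norm]
    intro η hη
    rw [ENNReal.tendsto_nhds_zero]
    intro e he
    -- eventual bound for the variances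
    have hbd : ∀ᶠ n in atTop, (4 : ℝ) * (N n / n0 n + N n / n1 n) ≤
        4 * (lam0⁻¹ + lam1⁻¹) + 1 :=
      (((hr0.add hr1).const_mul 4).eventually_lt_const (lt_add_one _)).mono fun _ hx => hx.le
    set C := 4 * (lam0⁻¹ + lam1⁻¹) + 1 with hC
    obtain ⟨K, hK0, hKe⟩ : ∃ K : ℝ, 0 < K ∧ ENNReal.ofReal (C / K ^ 2) ≤ e := by
      have h1 : Tendsto (fun K : ℝ => C / K ^ 2) atTop (𝓝 0) :=
        tendsto_const_nhds.div_atTop (tendsto_pow_atTop (by norm_num))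
      have h2 : Tendsto (fun K : ℝ => ENNReal.ofReal (C / K ^ 2)) atTop (𝓝 0) := by
        simpa [Function.comp_def] using (ENNReal.continuous_ofReal.tendsto 0).comp h1
      obtain ⟨K, hK⟩ := ((eventually_gt_atTop (0 : ℝ)).and
        ((ENNReal.tendsto_nhds_zero.1 h2) e he)).exists
      exact ⟨K, hK⟩
    have hloc := (hdiff.isLittleO.def (c := η / (2 * K)) (by positivity)).and
      (hU.mem_nhds hqU)
    obtain ⟨δ, hδ, hball⟩ := Metric.eventually_nhds_iff.1 hloc
    have hsq : Tendsto (fun n => √(N n)) atTop atTop := Real.tendsto_sqrt_atTop.comp hNtop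
    filter_upwards [hpos0, hpos1, hbd, hsq.eventually_gt_atTop (K / δ)] with n hp0 hp1 hb hs
    have hp0' : (0 : ℝ) < n0 n := by exact_mod_cast hp0
    have hp1' : (0 : ℝ) < n1 n := by exact_mod_cast hp1
    have hNpos : 0 < N n := by simp only [hN]; positivity
    have hsN : 0 < √(N n) := Real.sqrt_pos.2 hNpos
    have hcheb := cheb_two hq0 hq1 hp0 hp1 (c := K / √(N n)) (by positivity)
    refine (measure_mono ?_).trans (hcheb.trans (le_trans (ENNReal.ofReal_le_ofReal ?_) hKe))
    · intro ω hω
      rw [Set.mem_ofPred_eq] at hω ⊢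
      by_contra hlt
      rw [not_le] at hlt
      refine absurd hω (not_le.2 ?_)
      have hKd : K / √(N n) < δ := by
        rw [div_lt_iff₀ hδ] at hs
        rw [div_lt_iff₀ hsN]
        linarith
      obtain ⟨hlin, hxU⟩ := hball (y := freq (n0 n) (n1 n) ω)
        (by rw [dist_eq_norm]; exact hlt.trans hKd)
      have hGx := hGg _ ⟨hxU, cnt_simplex hp0 ω.1, cnt_simplex hp1 ω.2⟩
      have hsub : freq (n0 n) (n1 n) ω - (q0, q1) =
        (fun j => (cnt (n0 n) ω.1 j : ℝ) / n0 n - q0 j,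
          fun j => (cnt (n1 n) ω.2 j : ℝ) / n1 n - q1 j) := rfl
      have hA : fderiv ℝ G (q0, q1) (freq (n0 n) (n1 n) ω - (q0, q1)) =
          lin q0 (D 0) (n0 n) ω.1 + lin q1 (D 1) (n1 n) ω.2 := by
        rw [hsub, fderiv_decomp]
        simp only [lin, hD0, hD1]
      have hs0 : √(N n / n0 n) * √(n0 n : ℝ) = √(N n) := by
        rw [← Real.sqrt_mul (by positivity), div_mul_cancel₀ _ hp0'.ne']
      have hs1 : √(N n / n1 n) * √(n1 n : ℝ) = √(N n) := by
        rw [← Real.sqrt_mul (by positivity), div_mul_cancel₀ _ hp1'.ne']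
      have heq : (Φ n ∘ Prod.map (cnt (n0 n)) (cnt (n1 n))) ω -
          (√(N n / n0 n) * (√(n0 n : ℝ) * lin q0 (D 0) (n0 n) ω.1) +
            √(N n / n1 n) * (√(n1 n : ℝ) * lin q1 (D 1) (n1 n) ω.2)) =
          √(N n) * (G (freq (n0 n) (n1 n) ω) - G (q0, q1) -
            fderiv ℝ G (q0, q1) (freq (n0 n) (n1 n) ω - (q0, q1))) := by
        rw [← mul_assoc, ← mul_assoc, hs0, hs1, hA, hGx, hGq]
        have : (Φ n ∘ Prod.map (cnt (n0 n)) (cnt (n1 n))) ω =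
          √(N n) * (gval f (freq (n0 n) (n1 n) ω) - gval f (q0, q1)) := rfl
        rw [this]
        ring
      simp only [Pi.sub_apply, Pi.zero_apply, sub_zero]
      rw [heq, norm_mul, Real.norm_of_nonneg hsN.le]
      calc _ ≤ √(N n) * (η / (2 * K) * (K / √(N n))) := by
            gcongr
            exact hlin.trans (by gcongr)
        _ = η / 2 := by field_simp
        _ < η := by linarith
    · have h4 : (Fintype.card (Fin 2 × Fin 2) : ℝ) = 4 := by simp
      have h5 : (K / √(N n)) ^ 2 = K ^ 2 / N n := by rw [div_pow, Real.sq_sqrt hNpos.le]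
      rw [h4, h5]
      calc _ = (4 * (N n / n0 n + N n / n1 n)) / K ^ 2 := by field_simp
        _ ≤ C / K ^ 2 := by gcongr
  have hfin := ProbabilityMeasure.tendsto_iff_forall_integral_tendsto.1 hkey.tendsto h
  simp only [ProbabilityMeasure.coe_mk, Measure.map_id] at hfin
  convert! hfin using 2 with n
  rw [multinomial_eq_map, multinomial_eq_map,
    Measure.map_prod_map _ _ (measurable_cnt _) (measurable_cnt _),
    ← Measure.map_map (hΦm n) (hcm n),
    integral_map (hΦm n).aemeasurable h.continuous.measurable.aestronglyMeasurable]
end
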